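/- arXiv:2010.16378 — 6 statements merged into one kernel-verified Lean document; each statement's English description precedes it below -/
import Mathlib

section
/- Let C : ℝ → ℝ³ be a C² curve which is L-periodic for some L > 0 and parameterized by arc length, and let κ(s) := ‖C''(s)‖ be its curvature. Then the total squared curvature over one period satisfies ∫₀^L κ(s)² ds ≥ 4π²/L. -/
open Real MeasureTheory intervalIntegral

theorem wirtinger_aux (f f' : ℝ → ℝ) (L : ℝ) (hL : 0 < L)
    (hf : ∀ x, HasDerivAt f (f' x) x) (hc : Continuous f')
    (hper : f L = f 0) (hint : ∫ x in (0:ℝ)..L, f x = 0) :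
    (2 * π / L) ^ 2 * ∫ x in (0:ℝ)..L, f x ^ 2 ≤ ∫ x in (0:ℝ)..L, f' x ^ 2 := by
  have hcf : Continuous f := continuous_iff_continuousAt.2 fun x => (hf x).continuousAt
  have key : ∀ g : ℝ → ℝ, Continuous g →
      HasSum (fun i => ‖fourierCoeffOn hL (fun x => (g x : ℂ)) i‖ ^ 2)
        (L⁻¹ * ∫ x in (0:ℝ)..L, g x ^ 2) := by
    intro g hg
    have hgc : Continuous (fun x => (g x : ℂ)) := Complex.continuous_ofReal.comp hg
    have hm : MemLp (fun x => (g x : ℂ)) 2 (volume.restrict (Set.Ioc 0 L)) := by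
      rw [memLp_two_iff_integrable_sq_norm hgc.aestronglyMeasurable]
      exact (hgc.norm.pow 2).integrableOn_Ioc
    have := hasSum_sq_fourierCoeffOn hL hm
    simpa using this
  have h1 := (key f hcf).mul_left ((2 * π / L) ^ 2)
  have h2 := key f' hc
  have h3 := hasSum_le (fun n => ?_) h1 h2
  · have h4 : L⁻¹ * ((2 * π / L) ^ 2 * ∫ x in (0:ℝ)..L, f x ^ 2) ≤
        L⁻¹ * ∫ x in (0:ℝ)..L, f' x ^ 2 := by linarith
    exact le_of_mul_le_mul_left h4 (by positivity)
  · by_cases hn : n = 0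
    · subst hn
      have : fourierCoeffOn hL (fun x => (f x : ℂ)) 0 = 0 := by
        rw [fourierCoeffOn_eq_integral]
        simp [intervalIntegral.integral_ofReal, hint]
      rw [this]; simp
    · have := fourierCoeffOn_of_hasDerivAt hL hn (f := fun x => (f x : ℂ))
        (f' := fun x => (f' x : ℂ)) (fun x _ => (hf x).ofReal_comp)
        ((Complex.continuous_ofReal.comp hc).intervalIntegrable _ _)
      rw [this, hper]
      have hn1 : (1:ℝ) ≤ |(n:ℝ)| := by exact_mod_cast Int.one_le_abs hn
      simp only [sub_self, mul_zero, zero_sub, sub_zero, Complex.ofReal_zero, norm_mul, norm_neg, norm_div,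
        norm_one, Complex.norm_I, Complex.norm_real, Complex.norm_intCast, Complex.norm_ofNat,
        Real.norm_eq_abs, abs_of_pos pi_pos, abs_of_pos hL, ← mul_pow]
      have hp := pi_pos
      gcongr
      calc _ = ‖fourierCoeffOn hL (fun x => (f' x : ℂ)) n‖ / |(n:ℝ)| := by
            field_simp
        _ ≤ _ := div_le_self (norm_nonneg _) hn1

/-- For a closed (L-periodic) unit-speed C² curve in ℝ³, the total
squared curvature over one period is at least `4π²/L`. -/
theorem total_squared_curvature_lower_bound
    (C : ℝ → EuclideanSpace ℝ (Fin 3)) (L : ℝ) (hL : 0 < L)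
    (hC : ContDiff ℝ 2 C)
    (hper : ∀ s, C (s + L) = C s)
    (harc : ∀ s, ‖deriv C s‖ = 1) :
    4 * π ^ 2 / L ≤ ∫ s in (0:ℝ)..L, ‖deriv (deriv C) s‖ ^ 2 := by
  have hC1 : ContDiff ℝ 1 (deriv C) := by
    have : ContDiff ℝ (1 + 1) C := by simpa [one_add_one_eq_two] using hC
    exact (contDiff_succ_iff_deriv.1 this).2.2
  have hC2 : Continuous (deriv (deriv C)) := hC1.continuous_deriv le_rfl
  have hd : ∀ x, HasDerivAt C (deriv C x) x := fun x =>
    (hC.differentiable (by norm_num) x).hasDerivAt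
  have hd2 : ∀ x, HasDerivAt (deriv C) (deriv (deriv C) x) x := fun x =>
    (hC1.differentiable (by norm_num) x).hasDerivAt
  have hco : ∀ (g g' : ℝ → EuclideanSpace ℝ (Fin 3)), (∀ x, HasDerivAt g (g' x) x) → ∀ (i : Fin 3) (x : ℝ),
      HasDerivAt (fun x => g x i) (g' x i) x := fun g g' h i x =>
    (EuclideanSpace.proj (𝕜 := ℝ) i).hasFDerivAt.comp_hasDerivAt x (h x)
  have hcc : ∀ (g : ℝ → EuclideanSpace ℝ (Fin 3)), Continuous g → ∀ i : Fin 3,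
      Continuous (fun x => g x i) := fun g h i =>
    (EuclideanSpace.proj (𝕜 := ℝ) i).continuous.comp h
  have hperd : deriv C L = deriv C 0 := by
    have h : deriv (fun s => C (s + L)) 0 = deriv C 0 := by
      congr 1; funext s; exact hper s
    rw [deriv_comp_add_const] at h
    simpa using h
  have W : ∀ i : Fin 3, (2 * π / L) ^ 2 * ∫ x in (0:ℝ)..L, (deriv C x i) ^ 2 ≤
      ∫ x in (0:ℝ)..L, (deriv (deriv C) x i) ^ 2 := by
    intro i
    refine wirtinger_aux _ _ L hL (hco _ _ hd2 i) (hcc _ hC2 i) (by rw [hperd]) ?_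
    rw [integral_eq_sub_of_hasDerivAt (fun x _ => hco _ _ hd i x)
      ((hcc _ hC1.continuous i).intervalIntegrable _ _)]
    have := hper 0
    rw [zero_add] at this
    rw [this, sub_self]
  have S : ∀ g : ℝ → EuclideanSpace ℝ (Fin 3), Continuous g →
      ∫ x in (0:ℝ)..L, ‖g x‖ ^ 2 = ∑ i, ∫ x in (0:ℝ)..L, (g x i) ^ 2 := by
    intro g hg
    rw [← intervalIntegral.integral_finsetSum]
    · simp [EuclideanSpace.norm_sq_eq]
    · intro i _
      exact ((hcc g hg i).pow 2).intervalIntegrable _ _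
  rw [S _ hC2]
  have h1 := S _ hC1.continuous
  simp only [harc] at h1
  calc 4 * π ^ 2 / L = (2 * π / L) ^ 2 * L := by field_simp; ring
    _ = (2 * π / L) ^ 2 * ∑ i, ∫ x in (0:ℝ)..L, (deriv C x i) ^ 2 := by rw [← h1]; simp
    _ ≤ _ := by
      rw [Finset.mul_sum]
      exact Finset.sum_le_sum fun i _ => W i
end

section
/- Let C : ℝ → ℝ³ be a C² curve which is L-periodic for some L > 0 and parameterized by arc length, with curvature κ(s) := ‖C''(s)‖. Then equality ∫₀^L κ(s)² ds = 4π²/L holds if and only if C is a round circle of radius L/(2π); that is, if and only if there exist a point p ∈ ℝ³, orthonormal vectors A, B ∈ ℝ³, and a phase s₀ ∈ ℝ such that C(s) = p + (L/(2π))·(cos(2π(s−s₀)/L)·A + sin(2π(s−s₀)/L)·B) for all s. -/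
open Real MeasureTheory intervalIntegral

theorem aux_wirtinger (f f' : ℝ → ℝ) (L : ℝ) (hL : 0 < L)
    (hf : ∀ x, HasDerivAt f (f' x) x) (hf' : Continuous f')
    (hper : Function.Periodic f L) (hmean : ∫ x in (0:ℝ)..L, f x = 0) :
    (2 * π / L) ^ 2 * (∫ x in (0:ℝ)..L, f x ^ 2) ≤ ∫ x in (0:ℝ)..L, f' x ^ 2 ∧
    ((2 * π / L) ^ 2 * (∫ x in (0:ℝ)..L, f x ^ 2) = ∫ x in (0:ℝ)..L, f' x ^ 2 →
      ∃ a b : ℝ, ∀ s, f s = cos (2 * π * s / L) * a + sin (2 * π * s / L) * b) := by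
  have hfc : Continuous f := continuous_iff_continuousAt.2 fun x => (hf x).continuousAt
  set g : ℝ → ℂ := fun x => (f x : ℂ) with hg
  set g' : ℝ → ℂ := fun x => (f' x : ℂ) with hg'
  have hgc : Continuous g := Complex.continuous_ofReal.comp hfc
  have hgc' : Continuous g' := Complex.continuous_ofReal.comp hf'
  have hgd : ∀ x, HasDerivAt g (g' x) x := fun x => (hf x).ofReal_comp
  have mem : ∀ h : ℝ → ℂ, Continuous h → MemLp h 2 (volume.restrict (Set.Ioc 0 L)) := by
    intro h hh
    obtain ⟨K, hK⟩ := isCompact_Icc.exists_bound_of_continuousOn (hh.continuousOn (s := Set.Icc 0 L))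
    refine MemLp.of_bound hh.aestronglyMeasurable K ?_
    filter_upwards [ae_restrict_mem measurableSet_Ioc] with x hx
    exact hK x (Set.Ioc_subset_Icc_self hx)
  have S := hasSum_sq_fourierCoeffOn hL (mem g hgc)
  have S' := hasSum_sq_fourierCoeffOn hL (mem g' hgc')
  set c := fourierCoeffOn hL g with hc
  set c' := fourierCoeffOn hL g' with hc'
  have hpi := Real.pi_pos
  have hc0 : c 0 = 0 := by
    rw [hc, fourierCoeffOn_eq_integral]
    have : ∫ x in (0:ℝ)..L, g x = 0 := by
      rw [hg, intervalIntegral.integral_ofReal, hmean]; simp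
    simp [this]
  have hgL : g L = g 0 := by
    have := hper 0
    simp only [zero_add] at this
    simp [hg, this]
  have key : ∀ n : ℤ, ‖c' n‖ ^ 2 = (2 * π / L) ^ 2 * n ^ 2 * ‖c n‖ ^ 2 + (if n = 0 then ‖c' 0‖ ^ 2 else 0) := by
    intro n
    by_cases hn : n = 0
    · subst hn; simp
    · have h := fourierCoeffOn_of_hasDerivAt hL hn (fun x _ => hgd x)
        (hgc'.intervalIntegrable 0 L)
      rw [← hc, ← hc', hgL] at h
      have h2 : ‖c n‖ = L / (2 * π * |(n:ℝ)|) * ‖c' n‖ := by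
        rw [h]
        simp [abs_of_pos hpi, abs_of_pos hL]
        ring
      have hn' : |(n:ℝ)| ≠ 0 := by simpa using hn
      rw [h2, if_neg hn, ← sq_abs (n:ℝ)]
      field_simp
      ring
  have D := S'.sub (S.mul_left ((2 * π / L) ^ 2))
  have hterm : ∀ n : ℤ, ‖c' n‖ ^ 2 - (2 * π / L) ^ 2 * ‖c n‖ ^ 2 =
      (2 * π / L) ^ 2 * ((n:ℝ) ^ 2 - 1) * ‖c n‖ ^ 2 + (if n = 0 then ‖c' 0‖ ^ 2 else 0) := by
    intro n; rw [key n]; ring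
  have hpos : ∀ n : ℤ, 0 ≤ ‖c' n‖ ^ 2 - (2 * π / L) ^ 2 * ‖c n‖ ^ 2 := by
    intro n
    by_cases hn : n = 0
    · subst hn; rw [hc0]; simp
    · rw [hterm, if_neg hn, add_zero]
      have : (1:ℝ) ≤ (n:ℝ) ^ 2 := by
        have : 1 ≤ n ^ 2 := by have := sq_pos_of_ne_zero hn; omega
        exact_mod_cast this
      have : 0 ≤ (n:ℝ) ^ 2 - 1 := by linarith
      positivity
  have e1 : ∀ x, ‖g x‖ ^ 2 = f x ^ 2 := by intro x; simp [hg]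
  have e2 : ∀ x, ‖g' x‖ ^ 2 = f' x ^ 2 := by intro x; simp [hg']
  simp only [e1, e2, sub_zero, smul_eq_mul] at D
  have hD : L⁻¹ * (∫ x in (0:ℝ)..L, f' x ^ 2) - (2 * π / L) ^ 2 * (L⁻¹ * ∫ x in (0:ℝ)..L, f x ^ 2)
    = L⁻¹ * ((∫ x in (0:ℝ)..L, f' x ^ 2) - (2 * π / L) ^ 2 * ∫ x in (0:ℝ)..L, f x ^ 2) := by ring
  rw [hD] at D
  refine ⟨?_, ?_⟩
  · have := D.nonneg hpos
    have := nonneg_of_mul_nonneg_right this (by positivity)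
    linarith
  · intro heq
    rw [heq, sub_self, mul_zero] at D
    have hz := (hasSum_zero_iff_of_nonneg hpos).1 D
    have hcn : ∀ n : ℤ, n ≠ 1 → n ≠ -1 → c n = 0 := by
      intro n h1 h2
      by_cases hn : n = 0
      · rw [hn, hc0]
      · have h3 := congrFun hz n
        simp only [hterm, if_neg hn, add_zero, Pi.zero_apply] at h3
        have h4 : ((n:ℝ) ^ 2 - 1) ≠ 0 := by
          intro h
          have h5 : ((n:ℝ) - 1) * (n + 1) = 0 := by linarith
          rcases mul_eq_zero.1 h5 with h | h
          · apply h1; have : (n:ℝ) = 1 := by linarith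
            exact_mod_cast this
          · apply h2; have : (n:ℝ) = -1 := by linarith
            exact_mod_cast this
        have h6 : (2 * π / L) ^ 2 ≠ 0 := by positivity
        simpa [h4, hpi.ne', hL.ne'] using h3
    have : Fact (0 < L) := ⟨hL⟩
    have hgper : Function.Periodic g L := fun x => by simp [hg, hper x]
    let F : C(AddCircle L, ℂ) := ⟨hgper.lift, continuous_coinduced_dom.2 hgc⟩
    have hF : ∀ x : ℝ, F (x : AddCircle L) = g x := fun x => rfl
    have hFc : ∀ n, fourierCoeff F n = c n := by
      intro n
      rw [hc, fourierCoeffOn_eq_integral, fourierCoeff_eq_intervalIntegral _ _ 0]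
      simp only [hF, zero_add, fourier_coe_apply, sub_zero]
    have hsupp : ∀ n ∉ ({1, -1} : Finset ℤ), fourierCoeff F n = 0 := by
      intro n hn
      simp only [Finset.mem_insert, Finset.mem_singleton, not_or] at hn
      rw [hFc, hcn n hn.1 hn.2]
    have hsum : Summable (fourierCoeff F) := summable_of_ne_finset_zero hsupp
    refine ⟨(c 1).re + (c (-1)).re, (c (-1)).im - (c 1).im, fun s => ?_⟩
    have h1 := has_pointwise_sum_fourier_series_of_summable hsum (s : AddCircle L)
    have h2 := hasSum_sum_of_ne_finset_zero (L := SummationFilter.unconditional ℤ) (f := fun i => fourierCoeff F i • fourier i (s : AddCircle L))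
      (s := ({1, -1} : Finset ℤ)) (by intro n hn; simp only [hsupp n hn, zero_smul])
    have h3 := h1.unique h2
    rw [hF, Finset.sum_pair (by norm_num), hFc, hFc, fourier_coe_apply, fourier_coe_apply] at h3
    have a1 : (2 * π * Complex.I * (1:ℤ) * s / L : ℂ) = ((2 * π * s / L : ℝ) : ℂ) * Complex.I := by
      push_cast; ring
    have a2 : (2 * π * Complex.I * (-1:ℤ) * s / L : ℂ) = ((-(2 * π * s / L) : ℝ) : ℂ) * Complex.I := by
      push_cast; ring
    rw [a1, a2] at h3
    have h4 := congrArg Complex.re h3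
    simp only [hg, Complex.ofReal_re, smul_eq_mul, Complex.add_re, Complex.mul_re,
      Complex.exp_ofReal_mul_I_re, Complex.exp_ofReal_mul_I_im, Real.cos_neg, Real.sin_neg] at h4
    rw [h4]; ring

theorem aux_trig_deriv (L : ℝ) (s₀ : ℝ) {E : Type*} [NormedAddCommGroup E] [NormedSpace ℝ E]
    (A B : E) (s : ℝ) :
    HasDerivAt (fun s : ℝ => cos (2 * π * (s - s₀) / L) • A + sin (2 * π * (s - s₀) / L) • B)
      ((2 * π / L) • (cos (2 * π * (s - s₀) / L) • B + sin (2 * π * (s - s₀) / L) • (-A))) s := by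
  have h0 : HasDerivAt (fun s : ℝ => 2 * π * (s - s₀) / L) (2 * π / L) s := by
    have := (((hasDerivAt_id s).sub_const s₀).const_mul (2 * π)).div_const L
    simpa using this
  have := (h0.cos.smul_const A).add (h0.sin.smul_const B)
  have e : ((2 * π / L) • (cos (2 * π * (s - s₀) / L) • B + sin (2 * π * (s - s₀) / L) • (-A))) =
    (-sin (2 * π * (s - s₀) / L) * (2 * π / L)) • A +
      (cos (2 * π * (s - s₀) / L) * (2 * π / L)) • B := by module
  rw [e]
  exact this

theorem aux_norm {E : Type*} [NormedAddCommGroup E] [InnerProductSpace ℝ E]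
    (A B : E) (t : ℝ) :
    ‖cos t • A + sin t • B‖ ^ 2 = cos t ^ 2 * ‖A‖ ^ 2 + 2 * (cos t * sin t * inner ℝ A B)
      + sin t ^ 2 * ‖B‖ ^ 2 := by
  rw [norm_add_sq_real, norm_smul, norm_smul, mul_pow, mul_pow, inner_smul_left, inner_smul_right]
  simp
  ring

/-- For a closed (L-periodic) unit-speed C² curve in ℝ³, equality
`∫₀ᴸ κ² = 4π²/L` holds iff the curve is a round circle of radius `L/(2π)`. -/
theorem total_squared_curvature_eq_iff_circle
    (C : ℝ → EuclideanSpace ℝ (Fin 3)) (L : ℝ) (hL : 0 < L)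
    (hC : ContDiff ℝ 2 C)
    (hper : ∀ s, C (s + L) = C s)
    (harc : ∀ s, ‖deriv C s‖ = 1) :
    (∫ s in (0:ℝ)..L, ‖deriv (deriv C) s‖ ^ 2) = 4 * π ^ 2 / L ↔
      ∃ (p A B : EuclideanSpace ℝ (Fin 3)) (s₀ : ℝ),
        ‖A‖ = 1 ∧ ‖B‖ = 1 ∧ (inner ℝ A B : ℝ) = 0 ∧
        ∀ s, C s = p + (L / (2 * π)) •
          (Real.cos (2 * π * (s - s₀) / L) • A +
           Real.sin (2 * π * (s - s₀) / L) • B) := by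
  have hpi := Real.pi_pos
  have hT : ContDiff ℝ 1 (deriv C) := by
    have : ContDiff ℝ (1 + 1) C := by simpa [one_add_one_eq_two] using hC
    exact (contDiff_succ_iff_deriv.1 this).2.2
  have hT' : Continuous (deriv (deriv C)) := hT.continuous_deriv le_rfl
  have hTd : ∀ s, HasDerivAt (deriv C) (deriv (deriv C) s) s := fun s =>
    (hT.differentiable (by norm_num) s).hasDerivAt
  have hCd : ∀ s, HasDerivAt C (deriv C s) s := fun s =>
    (hC.differentiable (by norm_num) s).hasDerivAt
  have hTper : Function.Periodic (deriv C) L := by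
    intro s
    rw [← deriv_comp_add_const]
    congr 1
    funext x; exact hper x
  constructor
  · intro hE
    have coord : ∀ (G : ℝ → EuclideanSpace ℝ (Fin 3)) (v : EuclideanSpace ℝ (Fin 3)) (s : ℝ) (i : Fin 3),
        HasDerivAt G v s → HasDerivAt (fun s => G s i) (v i) s := by
      intro G v s i h
      exact (EuclideanSpace.proj (𝕜 := ℝ) i).hasFDerivAt.comp_hasDerivAt s h
    have hT'i : ∀ i, Continuous (fun s => deriv (deriv C) s i) := fun i =>
      (EuclideanSpace.proj (𝕜 := ℝ) i).continuous.comp hT'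
    have hTi : ∀ i, Continuous (fun s => deriv C s i) := fun i =>
      (EuclideanSpace.proj (𝕜 := ℝ) i).continuous.comp hT.continuous
    have W := fun i : Fin 3 => aux_wirtinger (fun s => deriv C s i) (fun s => deriv (deriv C) s i) L hL
      (fun s => coord _ _ s i (hTd s)) (hT'i i) (fun s => by simp only [hTper s]) (by
        rw [intervalIntegral.integral_eq_sub_of_hasDerivAt (f := fun s => C s i)
          (fun s _ => coord _ _ s i (hCd s)) ((hTi i).intervalIntegrable _ _)]
        have := hper 0
        rw [zero_add] at this
        simp [this])
    have I1 : ∑ i, ∫ s in (0:ℝ)..L, (deriv C s i) ^ 2 = L := by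
      rw [← intervalIntegral.integral_finsetSum (f := fun (i : Fin 3) (s : ℝ) => (deriv C s i) ^ 2)
        (fun i _ => ((hTi i).pow 2).intervalIntegrable _ _)]
      have : ∀ s, ∑ i, (deriv C s i) ^ 2 = 1 := by
        intro s; rw [← EuclideanSpace.real_norm_sq_eq, harc]; norm_num
      simp [this]
    have I2 : ∑ i, ∫ s in (0:ℝ)..L, (deriv (deriv C) s i) ^ 2 = 4 * π ^ 2 / L := by
      rw [← intervalIntegral.integral_finsetSum (f := fun (i : Fin 3) (s : ℝ) => (deriv (deriv C) s i) ^ 2)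
        (fun i _ => ((hT'i i).pow 2).intervalIntegrable _ _), ← hE]
      simp only [EuclideanSpace.real_norm_sq_eq]
    have hsum : ∑ i, (2 * π / L) ^ 2 * ∫ s in (0:ℝ)..L, (deriv C s i) ^ 2 =
        ∑ i, ∫ s in (0:ℝ)..L, (deriv (deriv C) s i) ^ 2 := by
      rw [← Finset.mul_sum, I1, I2]; field_simp; ring
    have heq := (Finset.sum_eq_sum_iff_of_le (fun i _ => (W i).1)).1 hsum
    choose a b hab using fun i => (W i).2 (heq i (Finset.mem_univ i))
    set A : EuclideanSpace ℝ (Fin 3) := WithLp.toLp 2 a with hA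
    set B : EuclideanSpace ℝ (Fin 3) := WithLp.toLp 2 b with hB
    have hTf : ∀ s, deriv C s = cos (2 * π * s / L) • A + sin (2 * π * s / L) • B := by
      intro s; ext i
      simp [hA, hB, hab i s]
    have hn : ∀ t, ‖cos t • A + sin t • B‖ ^ 2 = 1 := by
      intro t
      have h := hTf (t * L / (2 * π))
      have : 2 * π * (t * L / (2 * π)) / L = t := by field_simp
      rw [this] at h
      rw [← h, harc]; norm_num
    have hA1 : ‖A‖ ^ 2 = 1 := by simpa using hn 0
    have hB1 : ‖B‖ ^ 2 = 1 := by simpa using hn (π / 2)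
    have hAB : inner ℝ A B = 0 := by
      have h := hn (π / 4)
      rw [aux_norm, hA1, hB1] at h
      have h2 := Real.sin_sq_add_cos_sq (π / 4)
      have h3 : cos (π / 4) * sin (π / 4) ≠ 0 := by simp
      have h4 : cos (π / 4) * sin (π / 4) * inner ℝ A B = 0 := by linarith
      exact (mul_eq_zero.1 h4).resolve_left h3
    have hA1' : ‖A‖ = 1 := by
      have := norm_nonneg A; nlinarith
    have hB1' : ‖B‖ = 1 := by
      have := norm_nonneg B; nlinarith
    set G : ℝ → EuclideanSpace ℝ (Fin 3) := fun s => (L / (2 * π)) •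
          (Real.cos (2 * π * (s - 0) / L) • (-B) +
           Real.sin (2 * π * (s - 0) / L) • A) with hG
    have hGd : ∀ s, HasDerivAt G (deriv C s) s := by
      intro s
      have := (aux_trig_deriv L 0 (-B) A s).const_smul (L / (2 * π))
      have h1 : L / (2 * π) * (2 * π / L) = 1 := by field_simp
      rw [smul_smul, h1, one_smul, neg_neg] at this
      rw [hTf]
      rw [sub_zero] at this
      exact this
    have hdiff : ∀ s, HasDerivAt (fun s => C s - G s) 0 s := by
      intro s
      have := (hCd s).sub (hGd s)
      rwa [sub_self] at this
    have hconst := is_const_of_deriv_eq_zero (fun s => (hdiff s).differentiableAt) (fun s => (hdiff s).deriv)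
    refine ⟨C 0 - G 0, -B, A, 0, by simpa using hB1', hA1', ?_, fun s => ?_⟩
    · rw [inner_neg_left, real_inner_comm, hAB, neg_zero]
    · have := hconst s 0
      change C s = C 0 - G 0 + G s
      have h2 : C s - G s = C 0 - G 0 := this
      rw [← h2]; abel
  · rintro ⟨p, A, B, s₀, hA, hB, hAB, hCs⟩
    have h1 : deriv C = fun s => cos (2 * π * (s - s₀) / L) • B + sin (2 * π * (s - s₀) / L) • (-A) := by
      funext s
      have := ((aux_trig_deriv L s₀ A B s).const_smul (L / (2 * π))).const_add p
      have h2 : C = fun s => p + (L / (2 * π)) •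
          (Real.cos (2 * π * (s - s₀) / L) • A +
           Real.sin (2 * π * (s - s₀) / L) • B) := funext hCs
      rw [h2]
      refine this.deriv.trans ?_
      rw [smul_smul]
      have : L / (2 * π) * (2 * π / L) = 1 := by field_simp
      rw [this, one_smul]
    have h2 : ∀ s, ‖deriv (deriv C) s‖ ^ 2 = (2 * π / L) ^ 2 := by
      intro s
      rw [h1, (aux_trig_deriv L s₀ B (-A) s).deriv, norm_smul, mul_pow, aux_norm, norm_neg, norm_neg,
        hA, hB, inner_neg_neg, hAB]
      have := Real.sin_sq_add_cos_sq (2 * π * (s - s₀) / L)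
      have h3 : cos (2 * π * (s - s₀) / L) ^ 2 = 1 - sin (2 * π * (s - s₀) / L) ^ 2 := by linarith
      rw [h3, Real.norm_eq_abs, sq_abs]; ring
    simp only [h2]
    rw [intervalIntegral.integral_const]
    simp only [smul_eq_mul, sub_zero]
    field_simp
    ring
end

section
/- Let κ : ℝ → ℝ be twice differentiable and τ : ℝ → ℝ differentiable, and let μ, λ be real constants. Suppose that for all s: (E1) 2(κ(s) + μ)·τ'(s) + 4κ'(s)·τ(s) = 0 and (E2) 2κ''(s) + (κ(s)² − λ − μ²)·κ(s) − 2τ(s)²·(κ(s) + μ) = 0. Then the function s ↦ 4κ'(s)² + (κ(s)² − λ − μ²)² + 4τ(s)²·(κ(s) + μ)² is constant. -/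
/-- If `(κ, τ)` satisfy the two Euler–Lagrange equations of the bending
energy circular at rest, then `4(κ')² + (κ² − λ − μ²)² + 4τ²(κ + μ)²` is constant. -/
theorem first_integral_length_of_J
    (κ τ : ℝ → ℝ) (μ lam : ℝ)
    (hκ : Differentiable ℝ κ) (hκ' : Differentiable ℝ (deriv κ))
    (hτ : Differentiable ℝ τ)
    (hE1 : ∀ s, 2 * (κ s + μ) * deriv τ s + 4 * deriv κ s * τ s = 0)
    (hE2 : ∀ s, 2 * deriv (deriv κ) s + (κ s ^ 2 - lam - μ ^ 2) * κ s
        - 2 * τ s ^ 2 * (κ s + μ) = 0) :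
    ∃ d : ℝ, ∀ s,
      4 * deriv κ s ^ 2 + (κ s ^ 2 - lam - μ ^ 2) ^ 2 + 4 * τ s ^ 2 * (κ s + μ) ^ 2 = d := by
  have key : ∀ s, HasDerivAt (fun s => 4 * deriv κ s ^ 2 + (κ s ^ 2 - lam - μ ^ 2) ^ 2
      + 4 * τ s ^ 2 * (κ s + μ) ^ 2) 0 s := by
    intro s
    have h1 := (hκ s).hasDerivAt
    have h2 := (hκ' s).hasDerivAt
    have h3 := (hτ s).hasDerivAt
    have h := (((h2.fun_pow 2).const_mul 4).fun_add
      ((((h1.fun_pow 2).sub_const lam).sub_const (μ ^ 2)).fun_pow 2)).fun_add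
      (((h3.fun_pow 2).const_mul 4).fun_mul ((h1.add_const μ).fun_pow 2))
    refine h.congr_deriv ?_
    push_cast
    linear_combination 4 * deriv κ s * hE2 s + 4 * τ s * (κ s + μ) * hE1 s
  refine ⟨_, fun s => is_const_of_deriv_eq_zero (fun x => (key x).differentiableAt)
    (fun x => (key x).deriv) s 0⟩
end

section
/- Let f : ℂ → ℂ be continuous on the closed unit disc {z : |z| ≤ 1} and complex differentiable (holomorphic) on the open unit disc {z : |z| < 1}. If Re(z²·f(z)) = 0 for every z with |z| = 1, then f(z) = 0 for every z in the closed unit disc. -/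
/-- A function continuous on the closed unit disc and holomorphic on the
open unit disc whose boundary values satisfy `Re(z²·f(z)) = 0` vanishes identically. -/
theorem holomorphic_vanishes_of_re_zsq_boundary
    (f : ℂ → ℂ)
    (hfc : ContinuousOn f (Metric.closedBall 0 1))
    (hfd : DifferentiableOn ℂ f (Metric.ball 0 1))
    (hb : ∀ z ∈ Metric.sphere (0:ℂ) 1, (z ^ 2 * f z).re = 0) :
    ∀ z ∈ Metric.closedBall (0:ℂ) 1, f z = 0 := by
  have hcl : closure (Metric.ball (0:ℂ) 1) = Metric.closedBall 0 1 :=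
    closure_ball 0 one_ne_zero
  have hfD : DiffContOnCl ℂ f (Metric.ball 0 1) := ⟨hfd, by rw [hcl]; exact hfc⟩
  have key : ∀ (t : ℝ), ∀ z ∈ Metric.closedBall (0:ℂ) 1,
      Complex.exp ((t:ℂ) * (z ^ 2 * f z)) = 1 := by
    intro t
    have hD : DiffContOnCl ℂ (fun z => Complex.exp ((t:ℂ) * (z ^ 2 * f z)))
        (Metric.ball 0 1) := by
      refine ⟨?_, ?_⟩
      · fun_prop
      · rw [hcl]; fun_prop
    have hmax : IsMaxOn (norm ∘ fun z => Complex.exp ((t:ℂ) * (z ^ 2 * f z)))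
        (Metric.ball 0 1) 0 := by
      intro z hz
      have := Complex.norm_le_of_forall_mem_frontier_norm_le Metric.isBounded_ball hD
        (C := 1) (fun w hw => by
          rw [frontier_ball (0:ℂ) one_ne_zero] at hw
          rw [Complex.norm_exp, Complex.re_ofReal_mul, hb w hw]; simp) (subset_closure hz)
      simpa using this
    intro z hz
    have := Complex.eqOn_closedBall_of_isMaxOn_norm hD hmax hz
    simpa using this
  have hne : ∀ z ∈ Metric.closedBall (0:ℂ) 1, z ≠ 0 → f z = 0 := by
    intro z hz h0
    have h1 : HasDerivAt (fun t : ℝ => Complex.exp ((t:ℂ) * (z ^ 2 * f z)))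
        (Complex.exp (((0:ℝ):ℂ) * (z ^ 2 * f z)) * (1 * (z ^ 2 * f z))) 0 :=
      ((Complex.ofRealCLM.hasDerivAt (x := (0:ℝ))).mul_const (z ^ 2 * f z)).cexp
    have h2 : (fun t : ℝ => Complex.exp ((t:ℂ) * (z ^ 2 * f z))) = fun _ => 1 :=
      funext fun t => key t z hz
    rw [h2] at h1
    have := h1.unique (hasDerivAt_const (0:ℝ) (1:ℂ))
    simpa [h0] using this
  intro z hz
  by_cases h0 : z = 0
  · subst h0
    have hc : ContinuousAt f 0 :=
      hfc.continuousAt (Metric.closedBall_mem_nhds 0 one_pos)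
    have h1 : Filter.Tendsto f (nhdsWithin 0 {0}ᶜ) (nhds (f 0)) :=
      hc.tendsto.mono_left nhdsWithin_le_nhds
    have h2 : Filter.Tendsto f (nhdsWithin 0 {0}ᶜ) (nhds 0) := by
      refine tendsto_const_nhds.congr' ?_
      filter_upwards [self_mem_nhdsWithin,
        mem_nhdsWithin_of_mem_nhds (Metric.closedBall_mem_nhds (0:ℂ) one_pos)] with w hw hw'
      exact (hne w hw' hw).symm
    exact tendsto_nhds_unique h1 h2
  · exact hne z hz h0
end

section
/- Let f : ℂ → ℂ be continuous on the closed unit disc {z : |z| ≤ 1} and complex differentiable (holomorphic) on the open unit disc {z : |z| < 1}. Then there exists z with |z| = 1 such that Re(z²·f(z)) = 0. -/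
theorem aux_nonpos (g : ℂ → ℂ) (hg : DiffContOnCl ℂ g (Metric.ball 0 1)) (h0 : g 0 = 0) :
    ∃ z ∈ Metric.sphere (0:ℂ) 1, 0 ≤ (g z).re := by
  have he : DiffContOnCl ℂ (fun z => Complex.exp (g z)) (Metric.ball 0 1) :=
    ⟨hg.differentiableOn.cexp, hg.continuousOn.cexp⟩
  obtain ⟨z, hz, hmax⟩ := Complex.exists_mem_frontier_isMaxOn_norm Metric.isBounded_ball
    (Metric.nonempty_ball.2 one_pos) he
  rw [frontier_ball _ one_ne_zero] at hz
  refine ⟨z, hz, ?_⟩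
  have h := hmax (subset_closure (Metric.mem_ball_self one_pos) : (0:ℂ) ∈ _)
  simpa [Complex.norm_exp, h0] using h

/-- For any function continuous on the closed unit disc and holomorphic on
the open unit disc, `Re(z²·f(z))` vanishes at some point of the unit circle. -/
theorem exists_boundary_point_re_zsq_zero
    (f : ℂ → ℂ)
    (hfc : ContinuousOn f (Metric.closedBall 0 1))
    (hfd : DifferentiableOn ℂ f (Metric.ball 0 1)) :
    ∃ z ∈ Metric.sphere (0:ℂ) 1, (z ^ 2 * f z).re = 0 := by
  have hc : ContinuousOn (fun z => z ^ 2 * f z) (Metric.closedBall 0 1) := by fun_prop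
  have hg : DiffContOnCl ℂ (fun z => z ^ 2 * f z) (Metric.ball 0 1) :=
    ⟨by fun_prop, by rwa [closure_ball _ one_ne_zero]⟩
  obtain ⟨a, ha, ha'⟩ := aux_nonpos _ hg (by simp)
  obtain ⟨b, hb, hb'⟩ := aux_nonpos _ hg.neg (by simp)
  have hs : IsPreconnected (Metric.sphere (0:ℂ) 1) :=
    isPreconnected_sphere (by rw [Complex.rank_real_complex]; norm_num) _ _
  have hr : ContinuousOn (fun z => (z ^ 2 * f z).re) (Metric.sphere (0:ℂ) 1) :=
    Complex.continuous_re.comp_continuousOn (hc.mono Metric.sphere_subset_closedBall)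
  have hb2 : (b ^ 2 * f b).re ≤ 0 := by
    simp only [Pi.neg_apply, Complex.neg_re] at hb'
    linarith
  obtain ⟨z, hz, h⟩ := hs.intermediate_value hb ha hr ⟨hb2, ha'⟩
  exact ⟨z, hz, h⟩
end

section
/- Let α > 0, a > 0, c₀ ≠ 0, and let η, κ_n, τ_g be real constants with κ_n ≠ 0. Then there is no twice differentiable function f : I → ℝ on a nontrivial open interval I ⊆ ℝ satisfying both (α·f(s)² + η)·κ_n + 4α·f'(s)·τ_g = 0 and 2α·f''(s) + (α·f(s)² + η)·f(s) + 4a·c₀² = 0 for all s ∈ I. -/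
theorem aux_deriv_zero {g : ℝ → ℝ} {g' s : ℝ} (h : HasDerivAt g g' s)
    (h0 : ∀ᶠ t in nhds s, g t = 0) : g' = 0 := by
  have h1 : HasDerivAt g 0 s :=
    (hasDerivAt_const s (0 : ℝ)).congr_of_eventuallyEq h0
  exact h.unique h1

/-- The boundary Euler–Lagrange equations on a right circular cylinder
with `H = c₀ ≠ 0` admit no solution: there is no twice differentiable `f` on a nontrivial
open interval satisfying `(αf² + η)κₙ + 4αf'τ_g = 0` and
`2αf'' + (αf² + η)f + 4ac₀² = 0`. -/
theorem no_cylinder_critical_boundary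
    (α a c₀ η κn τg : ℝ) (hα : 0 < α) (ha : 0 < a) (hc₀ : c₀ ≠ 0) (hκn : κn ≠ 0)
    (x y : ℝ) (hxy : x < y) :
    ¬ ∃ f : ℝ → ℝ,
      (∀ s ∈ Set.Ioo x y, DifferentiableAt ℝ f s) ∧
      (∀ s ∈ Set.Ioo x y, DifferentiableAt ℝ (deriv f) s) ∧
      (∀ s ∈ Set.Ioo x y, (α * f s ^ 2 + η) * κn + 4 * α * deriv f s * τg = 0) ∧
      (∀ s ∈ Set.Ioo x y,
        2 * α * deriv (deriv f) s + (α * f s ^ 2 + η) * f s + 4 * a * c₀ ^ 2 = 0) := by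
  rintro ⟨f, hf, hf', h1, h2⟩
  have hI : ∀ s ∈ Set.Ioo x y, ∀ᶠ t in nhds s, t ∈ Set.Ioo x y :=
    fun s hs => isOpen_Ioo.mem_nhds hs
  have hC : 4 * a * c₀ ^ 2 ≠ 0 := by positivity
  have hD : 4 * τg ^ 2 + κn ^ 2 ≠ 0 := by positivity
  have hP : ∀ s ∈ Set.Ioo x y,
      HasDerivAt (fun t => α * f t ^ 2 + η) (α * (2 * f s * deriv f s)) s := by
    intro s hs
    have := (((hf s hs).hasDerivAt.pow 2).const_mul α).add_const η
    simpa using this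
  have e1 : ∀ s ∈ Set.Ioo x y,
      α * (2 * f s * deriv f s) * κn + 4 * α * deriv (deriv f) s * τg = 0 := by
    intro s hs
    exact aux_deriv_zero (((hP s hs).mul_const κn).add
      (((hf' s hs).hasDerivAt.const_mul (4 * α)).mul_const τg))
      ((hI s hs).mono fun t ht => h1 t ht)
  have e2 : ∀ s ∈ Set.Ioo x y, (4 * τg ^ 2 + κn ^ 2) * ((α * f s ^ 2 + η) * f s)
      + 4 * τg ^ 2 * (4 * a * c₀ ^ 2) = 0 := by
    intro s hs
    linear_combination (4 * τg ^ 2) * h2 s hs - 2 * τg * e1 s hs + κn * f s * h1 s hs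
  have e3 : ∀ s ∈ Set.Ioo x y, (3 * (α * f s ^ 2) + η) * deriv f s = 0 := by
    intro s hs
    have := aux_deriv_zero ((((hP s hs).mul (hf s hs).hasDerivAt).const_mul
      (4 * τg ^ 2 + κn ^ 2)).add_const (4 * τg ^ 2 * (4 * a * c₀ ^ 2)))
      ((hI s hs).mono fun t ht => e2 t ht)
    have := (mul_eq_zero.mp this).resolve_left hD
    linear_combination this
  have e4 : ∀ s ∈ Set.Ioo x y, deriv f s = 0 := by
    intro s hs
    by_contra hne
    have hev : ∀ᶠ t in nhds s, t ∈ Set.Ioo x y ∧ deriv f t ≠ 0 :=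
      (hI s hs).and ((hf' s hs).continuousAt.eventually_ne hne)
    have hf0 : ∀ᶠ t in nhds s, f t = 0 := by
      filter_upwards [hev.eventually_nhds, hev] with t ht ht'
      have := aux_deriv_zero (((hP t ht'.1).const_mul 3).add_const (-2 * η))
        (ht.mono fun u hu => by
          have := (mul_eq_zero.mp (e3 u hu.1)).resolve_right hu.2
          show 3 * (α * f u ^ 2 + η) + -2 * η = 0
          linear_combination this)
      have h3 := ht'.2
      simpa [hα.ne', h3] using this
    exact hne (aux_deriv_zero (hf s hs).hasDerivAt hf0)
  obtain ⟨s, hs⟩ := Set.nonempty_Ioo.mpr hxy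
  have d2 : deriv (deriv f) s = 0 :=
    aux_deriv_zero (hf' s hs).hasDerivAt ((hI s hs).mono fun t ht => e4 t ht)
  have k1 := h1 s hs
  have k2 := h2 s hs
  rw [e4 s hs] at k1
  have k3 : α * f s ^ 2 + η = 0 := by simpa [hκn] using k1
  rw [d2, k3] at k2
  exact hC (by linear_combination k2)
end
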